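/- For the Gaussian-kernel Transformer, the per-sample gradient with respect to the h-th query matrix satisfies ‖∇_{W^Q_h} f(M; X_i)‖_F ≤ Q′_i ‖MH(M; X_i) − y_i‖₂, where Q′_i = √(2n/d) ‖X_i‖_F³ ‖W^O‖₂ σ_max(W^V) √(σ_max²(W^Q_h) + σ_max²(W^K_h)). -/

import Mathlib

open scoped BigOperators
open scoped Matrix

noncomputable section

namespace Paper

/-- Euclidean (`ℓ²`) norm of a finite family of reals. -/
def enorm {ι : Type*} [Fintype ι] (v : ι → ℝ) : ℝ := Real.sqrt (∑ i, v i ^ 2)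

/-- Frobenius norm of a real matrix. -/
def frob {m k : Type*} [Fintype m] [Fintype k] (A : Matrix m k ℝ) : ℝ :=
  Real.sqrt (∑ i, ∑ j, A i j ^ 2)

/-- Largest singular value of a real matrix: `sup` of `‖A v‖₂` over unit vectors `v`. -/
def sigmaMax {m k : Type*} [Fintype m] [Fintype k] (A : Matrix m k ℝ) : ℝ :=
  sSup {c | ∃ v : k → ℝ, (∑ j, v j ^ 2) = 1 ∧ c = enorm (A.mulVec v)}

/-- Smallest singular value of a (full row rank) real matrix:
`inf` of `‖uᵀ A‖₂` over unit vectors `u`. -/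
def sigmaMin {m k : Type*} [Fintype m] [Fintype k] (A : Matrix m k ℝ) : ℝ :=
  sInf {c | ∃ u : m → ℝ, (∑ i, u i ^ 2) = 1 ∧ c = enorm (Matrix.vecMul u A)}

variable {N n D d H : ℕ}

/-- Attention logits `C = X W^Q (X W^K)ᵀ / √d`. -/
def attnC (WQ WK : Matrix (Fin D) (Fin d) ℝ) (Xi : Matrix (Fin n) (Fin D) ℝ) :
    Matrix (Fin n) (Fin n) ℝ :=
  (Real.sqrt (d : ℝ))⁻¹ • (Xi * WQ * (Xi * WK)ᵀ)

/-- Row-wise softmax of a square matrix. -/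
def softmaxMat (Z : Matrix (Fin n) (Fin n) ℝ) : Matrix (Fin n) (Fin n) ℝ :=
  Matrix.of fun k j => Real.exp (Z k j) / ∑ l, Real.exp (Z k l)

/-- Softmax attention kernel. -/
def Ssoft (WQ WK : Matrix (Fin D) (Fin d) ℝ) (Xi : Matrix (Fin n) (Fin D) ℝ) :
    Matrix (Fin n) (Fin n) ℝ :=
  softmaxMat (attnC WQ WK Xi)

/-- Gaussian attention kernel. -/
def Sgauss (WQ WK : Matrix (Fin D) (Fin d) ℝ) (Xi : Matrix (Fin n) (Fin D) ℝ) :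
    Matrix (Fin n) (Fin n) ℝ :=
  Matrix.of fun k j =>
    Real.exp (-(∑ l, (Matrix.vecMul (Xi k) WQ l - Matrix.vecMul (Xi j) WK l) ^ 2) /
      (2 * Real.sqrt (d : ℝ)))

/-- Multi-head attention output on one sample, for given head kernels `S h`. -/
def MH (S : Fin H → Matrix (Fin n) (Fin n) ℝ) (WV : Fin H → Matrix (Fin D) (Fin d) ℝ)
    (WO : Fin H → Fin d → ℝ) (Xi : Matrix (Fin n) (Fin D) ℝ) : Fin n → ℝ :=
  fun k => ∑ h, ∑ l, (S h * Xi * WV h) k l * WO h l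

/-- Squared-error loss `½ Σᵢ ‖out i − y i‖²`. -/
def lossOf (out y : Fin N → Fin n → ℝ) : ℝ :=
  (1 / 2) * ∑ i, ∑ k, (out i k - y i k) ^ 2

/-- The stacked matrix `B ∈ ℝ^{Nn × HD}` whose `(i,h)` block is `S_{ih} X_i`. -/
def Bmat (S : Fin N → Fin H → Matrix (Fin n) (Fin n) ℝ)
    (X : Fin N → Matrix (Fin n) (Fin D) ℝ) :
    Matrix (Fin N × Fin n) (Fin H × Fin D) ℝ :=
  Matrix.of fun ik hp => (S ik.1 hp.1 * X ik.1) ik.2 hp.2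

/-- Block-diagonal stacked value matrix `W^V = diag(W^V_1, …, W^V_H)`. -/
def diagWV (WV : Fin H → Matrix (Fin D) (Fin d) ℝ) :
    Matrix (Fin H × Fin D) (Fin H × Fin d) ℝ :=
  Matrix.of fun hp hq => if hp.1 = hq.1 then WV hp.1 hp.2 hq.2 else 0

/-- Euclidean norm of the output weight `W^O ∈ ℝ^{Hd×1}`. -/
def WOnorm (WO : Fin H → Fin d → ℝ) : ℝ := enorm fun hl : Fin H × Fin d => WO hl.1 hl.2

/-- Frobenius norm of the row-stacked data matrix `X ∈ ℝ^{Nn×D}`. -/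
def XF (X : Fin N → Matrix (Fin n) (Fin D) ℝ) : ℝ :=
  Real.sqrt (∑ i, ∑ k, ∑ p, X i k p ^ 2)

/-- The `h`-th head matrix of a packed head-indexed parameter vector. -/
def headMat (v : EuclideanSpace ℝ (Fin H × Fin D × Fin d)) (h : Fin H) :
    Matrix (Fin D) (Fin d) ℝ :=
  Matrix.of fun p q => v (h, p, q)

/-- Index type for the full parameter set `M = (W^Q, W^K, W^V)`. -/
abbrev FullIdx (H D d : ℕ) := Fin 3 × Fin H × Fin D × Fin d

/-- Query weights of the packed full parameter vector. -/
def mQ (v : EuclideanSpace ℝ (FullIdx H D d)) (h : Fin H) : Matrix (Fin D) (Fin d) ℝ :=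
  Matrix.of fun p q => v (0, h, p, q)

/-- Key weights of the packed full parameter vector. -/
def mK (v : EuclideanSpace ℝ (FullIdx H D d)) (h : Fin H) : Matrix (Fin D) (Fin d) ℝ :=
  Matrix.of fun p q => v (1, h, p, q)

/-- Value weights of the packed full parameter vector. -/
def mV (v : EuclideanSpace ℝ (FullIdx H D d)) (h : Fin H) : Matrix (Fin D) (Fin d) ℝ :=
  Matrix.of fun p q => v (2, h, p, q)

/-- A packed `D × d` parameter vector as a matrix. -/
def toMat2 {D d : ℕ} (w : EuclideanSpace ℝ (Fin D × Fin d)) : Matrix (Fin D) (Fin d) ℝ :=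
  Matrix.of fun p q => w (p, q)

lemma enorm_eq_norm {ι : Type*} [Fintype ι] (v : ι → ℝ) :
    enorm v = ‖(WithLp.toLp 2 v : EuclideanSpace ℝ ι)‖ := by
  simp [enorm, EuclideanSpace.norm_eq]

lemma enorm_nonneg' {ι : Type*} [Fintype ι] (v : ι → ℝ) : 0 ≤ enorm v := Real.sqrt_nonneg _

lemma enorm_sq {ι : Type*} [Fintype ι] (v : ι → ℝ) : enorm v ^ 2 = ∑ i, v i ^ 2 :=
  Real.sq_sqrt (Finset.sum_nonneg fun _ _ => sq_nonneg _)

lemma abs_sum_mul_le {ι : Type*} [Fintype ι] (a b : ι → ℝ) :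
    |∑ i, a i * b i| ≤ enorm a * enorm b := by
  refine abs_le_of_sq_le_sq ?_ (mul_nonneg (enorm_nonneg' a) (enorm_nonneg' b))
  rw [mul_pow, enorm_sq, enorm_sq]
  exact Finset.sum_mul_sq_le_sq_mul_sq _ _ _

lemma enorm_sub_le {ι : Type*} [Fintype ι] (a b : ι → ℝ) :
    enorm (fun i => a i - b i) ≤ enorm a + enorm b := by
  rw [enorm_eq_norm, enorm_eq_norm, enorm_eq_norm]
  exact norm_sub_le (WithLp.toLp 2 a : EuclideanSpace ℝ ι) (WithLp.toLp 2 b)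

lemma enorm_smul' {ι : Type*} [Fintype ι] (c : ℝ) (a : ι → ℝ) :
    enorm (c • a) = |c| * enorm a := by
  rw [enorm_eq_norm, enorm_eq_norm, WithLp.toLp_smul, norm_smul, Real.norm_eq_abs]

lemma frob_nonneg {m k : Type*} [Fintype m] [Fintype k] (A : Matrix m k ℝ) : 0 ≤ frob A :=
  Real.sqrt_nonneg _

lemma frob_sq {m k : Type*} [Fintype m] [Fintype k] (A : Matrix m k ℝ) :
    frob A ^ 2 = ∑ i, ∑ j, A i j ^ 2 :=
  Real.sq_sqrt (Finset.sum_nonneg fun _ _ => Finset.sum_nonneg fun _ _ => sq_nonneg _)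

lemma enorm_mulVec_le_frob {m k : Type*} [Fintype m] [Fintype k] (A : Matrix m k ℝ)
    (v : k → ℝ) : enorm (A.mulVec v) ≤ frob A * enorm v := by
  refine (sq_le_sq₀ (enorm_nonneg' _) (mul_nonneg (frob_nonneg _) (enorm_nonneg' _))).1 ?_
  rw [mul_pow, enorm_sq, enorm_sq, frob_sq, Finset.sum_mul]
  exact Finset.sum_le_sum fun i _ => Finset.sum_mul_sq_le_sq_mul_sq _ _ _

lemma enorm_vecMul_le_frob {m k : Type*} [Fintype m] [Fintype k] (A : Matrix m k ℝ)
    (v : m → ℝ) : enorm (Matrix.vecMul v A) ≤ enorm v * frob A := by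
  refine (sq_le_sq₀ (enorm_nonneg' _) (mul_nonneg (enorm_nonneg' _) (frob_nonneg _))).1 ?_
  rw [mul_pow, enorm_sq, enorm_sq, frob_sq, Finset.sum_comm (s := (Finset.univ : Finset m)),
    Finset.mul_sum]
  exact Finset.sum_le_sum fun i _ => Finset.sum_mul_sq_le_sq_mul_sq _ _ _

lemma sigmaMax_nonneg {m k : Type*} [Fintype m] [Fintype k] (A : Matrix m k ℝ) :
    0 ≤ sigmaMax A := by
  apply Real.sSup_nonneg
  rintro c ⟨v, -, rfl⟩
  exact enorm_nonneg' _

lemma enorm_mulVec_le {m k : Type*} [Fintype m] [Fintype k] (A : Matrix m k ℝ)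
    (v : k → ℝ) : enorm (A.mulVec v) ≤ sigmaMax A * enorm v := by
  rcases (enorm_nonneg' v).eq_or_lt with h0 | hpos
  · have := enorm_mulVec_le_frob A v
    rw [← h0] at this ⊢
    simpa using this
  · have hb : BddAbove {c | ∃ v : k → ℝ, (∑ j, v j ^ 2) = 1 ∧ c = enorm (A.mulVec v)} := by
      refine ⟨frob A, ?_⟩
      rintro c ⟨u, hu, rfl⟩
      have := enorm_mulVec_le_frob A u
      simpa [enorm, hu] using this
    have h1 : enorm (A.mulVec ((enorm v)⁻¹ • v)) ≤ sigmaMax A := by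
      refine le_csSup hb ⟨_, ?_, rfl⟩
      rw [← enorm_sq, enorm_smul', abs_of_pos (inv_pos.2 hpos), inv_mul_cancel₀ hpos.ne', one_pow]
    rw [Matrix.mulVec_smul, enorm_smul', abs_of_pos (inv_pos.2 hpos), inv_mul_le_iff₀ hpos] at h1
    linarith

lemma enorm_vecMul_le {m k : Type*} [Fintype m] [Fintype k] (A : Matrix m k ℝ)
    (u : m → ℝ) : enorm (Matrix.vecMul u A) ≤ sigmaMax A * enorm u := by
  rcases (enorm_nonneg' (Matrix.vecMul u A)).eq_or_lt with h0 | hpos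
  · rw [← h0]; exact mul_nonneg (sigmaMax_nonneg _) (enorm_nonneg' _)
  · have h1 : enorm (Matrix.vecMul u A) ^ 2 = ∑ i, u i * (A.mulVec (Matrix.vecMul u A)) i := by
      rw [enorm_sq]
      have := Matrix.dotProduct_mulVec u A (Matrix.vecMul u A)
      simp only [dotProduct] at this
      rw [this]
      exact Finset.sum_congr rfl fun _ _ => sq _
    have h2 := (le_abs_self _).trans (abs_sum_mul_le u (A.mulVec (Matrix.vecMul u A)))
    have h3 := mul_le_mul_of_nonneg_left (enorm_mulVec_le A (Matrix.vecMul u A)) (enorm_nonneg' u)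
    rw [← h1] at h2
    nlinarith

/-- the value contribution of token `j` through one head -/
def uvec {n D d : ℕ} (WV : Matrix (Fin D) (Fin d) ℝ) (WO : Fin d → ℝ)
    (Xi : Matrix (Fin n) (Fin D) ℝ) (j : Fin n) : ℝ := ∑ p, Xi j p * (WV.mulVec WO) p

lemma MH_eq {n D d H : ℕ} (S : Fin H → Matrix (Fin n) (Fin n) ℝ)
    (WV : Fin H → Matrix (Fin D) (Fin d) ℝ)
    (WO : Fin H → Fin d → ℝ) (Xi : Matrix (Fin n) (Fin D) ℝ) (k : Fin n) :
    MH S WV WO Xi k = ∑ h, ∑ j, S h k j * uvec (WV h) (WO h) Xi j := by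
  unfold MH
  refine Finset.sum_congr rfl fun h _ => ?_
  change ((S h * Xi * WV h).mulVec (WO h)) k = (S h).mulVec (Xi.mulVec ((WV h).mulVec (WO h))) k
  simp [Matrix.mulVec_mulVec, Matrix.mul_assoc]

lemma uvec_bound {n D d H : ℕ} (WV : Fin H → Matrix (Fin D) (Fin d) ℝ)
    (WO : Fin H → Fin d → ℝ) (Xi : Matrix (Fin n) (Fin D) ℝ) (h : Fin H) (j : Fin n) :
    |uvec (WV h) (WO h) Xi j| ≤ enorm (Xi j) * (sigmaMax (diagWV WV) * WOnorm WO) := by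
  refine (abs_sum_mul_le _ _).trans (mul_le_mul_of_nonneg_left ?_ (enorm_nonneg' _))
  refine le_trans ?_ (enorm_mulVec_le (diagWV WV) (fun hl : Fin H × Fin d => WO hl.1 hl.2))
  apply Real.sqrt_le_sqrt
  rw [Fintype.sum_prod_type]
  refine le_trans (le_of_eq ?_) (Finset.single_le_sum (f := fun h' => ∑ p, ((diagWV WV).mulVec
    (fun hl : Fin H × Fin d => WO hl.1 hl.2) (h', p)) ^ 2) (fun _ _ => Finset.sum_nonneg fun _ _ => sq_nonneg _) (Finset.mem_univ h))
  refine Finset.sum_congr rfl fun p _ => ?_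
  congr 1
  simp [Matrix.mulVec, dotProduct, diagWV, Fintype.sum_prod_type, ite_mul, Finset.sum_ite_irrel]

lemma f_diff {n D d H : ℕ}
    (Xi : Matrix (Fin n) (Fin D) ℝ) (yi : Fin n → ℝ)
    (WK WV : Fin H → Matrix (Fin D) (Fin d) ℝ) (WO : Fin H → Fin d → ℝ) :
    Differentiable ℝ (fun v : EuclideanSpace ℝ (Fin H × Fin D × Fin d) =>
      (1 / 2) * ∑ k, (MH (fun h => Sgauss (headMat v h) (WK h) Xi) WV WO Xi k - yi k) ^ 2) := by
  simp only [MH_eq, Sgauss, headMat, Matrix.of_apply, Matrix.vecMul, dotProduct]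
  fun_prop

/-- directional derivative of the kernel entry -/
def dS {n D d : ℕ} (WQ WK W : Matrix (Fin D) (Fin d) ℝ) (Xi : Matrix (Fin n) (Fin D) ℝ)
    (k j : Fin n) : ℝ :=
  Sgauss WQ WK Xi k j * (-(∑ l, 2 * (Matrix.vecMul (Xi k) WQ l - Matrix.vecMul (Xi j) WK l) *
      Matrix.vecMul (Xi k) W l) / (2 * Real.sqrt (d : ℝ)))

lemma S_deriv {n D d : ℕ} (WQ WK W : Matrix (Fin D) (Fin d) ℝ) (Xi : Matrix (Fin n) (Fin D) ℝ)
    (k j : Fin n) :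
    HasDerivAt (fun t : ℝ => Sgauss (WQ + t • W) WK Xi k j) (dS WQ WK W Xi k j) 0 := by
  simp only [Sgauss, dS, Matrix.of_apply, Matrix.vecMul_add, Matrix.vecMul_smul, Pi.add_apply,
    Pi.smul_apply, smul_eq_mul]
  have h1 : ∀ l, HasDerivAt (fun t : ℝ => (Matrix.vecMul (Xi k) WQ l + t * Matrix.vecMul (Xi k) W l
      - Matrix.vecMul (Xi j) WK l) ^ 2) (2 * (Matrix.vecMul (Xi k) WQ l - Matrix.vecMul (Xi j) WK l) *
      Matrix.vecMul (Xi k) W l) 0 := by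
    intro l
    have := (((((hasDerivAt_id (0:ℝ)).mul_const (Matrix.vecMul (Xi k) W l)).const_add
      (Matrix.vecMul (Xi k) WQ l)).sub_const (Matrix.vecMul (Xi j) WK l))).fun_pow 2
    refine this.congr_deriv ?_
    simp
  have h2 := (((HasDerivAt.fun_sum (u := Finset.univ) fun l _ => h1 l).fun_neg).div_const
    (2 * Real.sqrt (d : ℝ))).exp
  simpa using h2

lemma Sgauss_abs_le {n D d : ℕ} (WQ WK : Matrix (Fin D) (Fin d) ℝ)
    (Xi : Matrix (Fin n) (Fin D) ℝ) (k j : Fin n) : |Sgauss WQ WK Xi k j| ≤ 1 := by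
  simp only [Sgauss, Matrix.of_apply, Real.abs_exp, Real.exp_le_one_iff]
  apply div_nonpos_of_nonpos_of_nonneg
  · exact neg_nonpos.2 (Finset.sum_nonneg fun _ _ => sq_nonneg _)
  · positivity

lemma row_le {n D : ℕ} (Xi : Matrix (Fin n) (Fin D) ℝ) (k : Fin n) : enorm (Xi k) ≤ frob Xi :=
  Real.sqrt_le_sqrt (Finset.single_le_sum (f := fun i => ∑ j, Xi i j ^ 2)
    (fun _ _ => Finset.sum_nonneg fun _ _ => sq_nonneg _) (Finset.mem_univ k))

lemma enorm_rows {n D : ℕ} (Xi : Matrix (Fin n) (Fin D) ℝ) :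
    enorm (fun k => enorm (Xi k)) = frob Xi := by
  simp only [enorm, frob]
  congr 1
  exact Finset.sum_congr rfl fun k _ => enorm_sq (Xi k)

lemma diff_bound {n D d : ℕ} (WQ WK : Matrix (Fin D) (Fin d) ℝ)
    (Xi : Matrix (Fin n) (Fin D) ℝ) (k j : Fin n) :
    enorm (fun l => Matrix.vecMul (Xi k) WQ l - Matrix.vecMul (Xi j) WK l) ≤
      Real.sqrt (sigmaMax WQ ^ 2 + sigmaMax WK ^ 2) * (Real.sqrt 2 * frob Xi) := by
  have h1 := enorm_sub_le (Matrix.vecMul (Xi k) WQ) (Matrix.vecMul (Xi j) WK)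
  have h2 := (enorm_vecMul_le WQ (Xi k)).trans
    (mul_le_mul_of_nonneg_left (row_le Xi k) (sigmaMax_nonneg _))
  have h3 := (enorm_vecMul_le WK (Xi j)).trans
    (mul_le_mul_of_nonneg_left (row_le Xi j) (sigmaMax_nonneg _))
  have h4 : sigmaMax WQ + sigmaMax WK ≤ Real.sqrt (sigmaMax WQ ^ 2 + sigmaMax WK ^ 2) * Real.sqrt 2 := by
    rw [← Real.sqrt_mul (by positivity)]
    apply Real.le_sqrt_of_sq_le
    nlinarith [sq_nonneg (sigmaMax WQ - sigmaMax WK)]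
  have h5 := mul_le_mul_of_nonneg_right h4 (frob_nonneg Xi)
  linarith

lemma dS_bound {n D d : ℕ} (WQ WK W : Matrix (Fin D) (Fin d) ℝ)
    (Xi : Matrix (Fin n) (Fin D) ℝ) (k j : Fin n) :
    |dS WQ WK W Xi k j| ≤ (Real.sqrt (sigmaMax WQ ^ 2 + sigmaMax WK ^ 2) * (Real.sqrt 2 * frob Xi)
      * (enorm (Xi k) * frob W)) / Real.sqrt d := by
  have e : (-(∑ l, 2 * (Matrix.vecMul (Xi k) WQ l - Matrix.vecMul (Xi j) WK l) *
      Matrix.vecMul (Xi k) W l) / (2 * Real.sqrt (d : ℝ))) =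
      -(∑ l, (Matrix.vecMul (Xi k) WQ l - Matrix.vecMul (Xi j) WK l) *
      Matrix.vecMul (Xi k) W l) / Real.sqrt (d : ℝ) := by
    simp only [mul_assoc, ← Finset.mul_sum]
    rw [← mul_neg, mul_div_mul_left _ _ two_ne_zero]
  rw [dS, e, abs_mul]
  refine (mul_le_of_le_one_left (abs_nonneg _) (Sgauss_abs_le _ _ _ _ _)).trans ?_
  rw [abs_div, abs_neg, abs_of_nonneg (Real.sqrt_nonneg _)]
  refine div_le_div_of_nonneg_right ?_ (Real.sqrt_nonneg _)
  refine (abs_sum_mul_le _ _).trans ?_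
  exact mul_le_mul (diff_bound _ _ _ _ _) (enorm_vecMul_le_frob _ _) (enorm_nonneg' _)
    (mul_nonneg (Real.sqrt_nonneg _) (mul_nonneg (Real.sqrt_nonneg _) (frob_nonneg _)))

lemma sum_enorm_le {n D : ℕ} (Xi : Matrix (Fin n) (Fin D) ℝ) :
    ∑ j, enorm (Xi j) ≤ Real.sqrt n * frob Xi := by
  have := (le_abs_self _).trans (abs_sum_mul_le (fun _ : Fin n => (1:ℝ)) (fun j => enorm (Xi j)))
  rw [enorm_rows] at this
  simpa [enorm] using this

/-- The gradient bound, as a bound on directional derivatives. -/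
lemma dir_bound {n D d H : ℕ} (Xi : Matrix (Fin n) (Fin D) ℝ) (r : Fin n → ℝ)
    (WQ WK W : Matrix (Fin D) (Fin d) ℝ) (WV : Fin H → Matrix (Fin D) (Fin d) ℝ)
    (WO : Fin H → Fin d → ℝ) (h : Fin H) :
    ∑ k, r k * ∑ j, dS WQ WK W Xi k j * uvec (WV h) (WO h) Xi j ≤
      (Real.sqrt (2 * n / (d : ℝ)) * frob Xi ^ 3 * WOnorm WO * sigmaMax (diagWV WV) *
            Real.sqrt (sigmaMax WQ ^ 2 + sigmaMax WK ^ 2)) * enorm r * frob W := by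
  set R := Real.sqrt (sigmaMax WQ ^ 2 + sigmaMax WK ^ 2) with hR
  set T := sigmaMax (diagWV WV) * WOnorm WO with hT
  have hT0 : 0 ≤ T := mul_nonneg (sigmaMax_nonneg _) (Real.sqrt_nonneg _)
  have hR0 : 0 ≤ R := Real.sqrt_nonneg _
  have hF0 := frob_nonneg Xi
  have hW0 := frob_nonneg W
  set c := R * (Real.sqrt 2 * frob Xi) * frob W / Real.sqrt d * T with hc
  have hc0 : 0 ≤ c := by positivity
  have hk : ∀ k, |∑ j, dS WQ WK W Xi k j * uvec (WV h) (WO h) Xi j| ≤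
      c * (Real.sqrt n * frob Xi) * enorm (Xi k) := by
    intro k
    calc _ ≤ ∑ j, |dS WQ WK W Xi k j * uvec (WV h) (WO h) Xi j| := Finset.abs_sum_le_sum_abs _ _
      _ ≤ ∑ j, (c * enorm (Xi k)) * enorm (Xi j) := by
        refine Finset.sum_le_sum fun j _ => ?_
        rw [abs_mul]
        refine (mul_le_mul (dS_bound WQ WK W Xi k j) (uvec_bound WV WO Xi h j) (abs_nonneg _)
          ((abs_nonneg _).trans (dS_bound WQ WK W Xi k j))).trans (le_of_eq ?_)
        rw [hc, hT, hR]; ring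
      _ = (c * enorm (Xi k)) * ∑ j, enorm (Xi j) := by rw [Finset.mul_sum]
      _ ≤ (c * enorm (Xi k)) * (Real.sqrt n * frob Xi) :=
        mul_le_mul_of_nonneg_left (sum_enorm_le Xi) (mul_nonneg hc0 (enorm_nonneg' _))
      _ = _ := by ring
  have hr : ∑ k, |r k| * enorm (Xi k) ≤ enorm r * frob Xi := by
    have := (le_abs_self _).trans (abs_sum_mul_le (fun k => |r k|) (fun j => enorm (Xi j)))
    rw [enorm_rows] at this
    simpa [enorm, sq_abs] using this
  calc _ ≤ ∑ k, c * (Real.sqrt n * frob Xi) * (|r k| * enorm (Xi k)) := by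
        refine Finset.sum_le_sum fun k _ => (le_abs_self _).trans ?_
        rw [abs_mul]
        refine (mul_le_mul_of_nonneg_left (hk k) (abs_nonneg _)).trans (le_of_eq (by ring))
    _ = c * (Real.sqrt n * frob Xi) * ∑ k, |r k| * enorm (Xi k) := by rw [Finset.mul_sum]
    _ ≤ c * (Real.sqrt n * frob Xi) * (enorm r * frob Xi) :=
        mul_le_mul_of_nonneg_left hr (by positivity)
    _ = _ := by
        rw [Real.sqrt_div (by positivity), Real.sqrt_mul (by norm_num), hc, hT]
        ring

/-- Lemma 8(4) of the paper. For the Gaussian-kernel Transformer, the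
per-sample gradient with respect to the `h`-th query matrix satisfies
`‖∇_{W^Q_h} f(M;X_i)‖_F ≤ Q′_i ‖MH(M;X_i) − y_i‖₂` with
`Q′_i = √(2n/d) ‖X_i‖_F³ ‖W^O‖₂ σ_max(W^V) √(σ_max²(W^Q_h) + σ_max²(W^K_h))`. -/
theorem gaussian_per_sample_query_gradient_bound
    {n D d H : ℕ}
    (Xi : Matrix (Fin n) (Fin D) ℝ) (yi : Fin n → ℝ)
    (WK WV : Fin H → Matrix (Fin D) (Fin d) ℝ) (WO : Fin H → Fin d → ℝ)
    (f : EuclideanSpace ℝ (Fin H × Fin D × Fin d) → ℝ)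
    (hf : f = fun v =>
      (1 / 2) * ∑ k, (MH (fun h => Sgauss (headMat v h) (WK h) Xi) WV WO Xi k - yi k) ^ 2) :
    ∀ (v : EuclideanSpace ℝ (Fin H × Fin D × Fin d)) (h : Fin H),
      Real.sqrt (∑ p, ∑ q, gradient f v (h, p, q) ^ 2) ≤
        (Real.sqrt (2 * n / (d : ℝ)) * frob Xi ^ 3 * WOnorm WO * sigmaMax (diagWV WV) *
            Real.sqrt (sigmaMax (headMat v h) ^ 2 + sigmaMax (WK h) ^ 2)) *
          enorm (fun k => MH (fun h' => Sgauss (headMat v h') (WK h') Xi) WV WO Xi k - yi k) := by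
  intro v h
  have hd : DifferentiableAt ℝ f v := by rw [hf]; exact (f_diff Xi yi WK WV WO) v
  set W : Matrix (Fin D) (Fin d) ℝ := headMat (gradient f v) h with hW
  have hfW : Real.sqrt (∑ p, ∑ q, gradient f v (h, p, q) ^ 2) = frob W := rfl
  rw [hfW]
  set w : EuclideanSpace ℝ (Fin H × Fin D × Fin d) :=
    WithLp.toLp 2 (fun i => if i.1 = h then W i.2.1 i.2.2 else 0) with hw
  have hwh : ∀ h', headMat w h' = if h' = h then W else 0 := by
    intro h'
    ext p q
    by_cases e : h' = h <;> simp [headMat, hw, e]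
  have hhead : ∀ (t : ℝ) h', headMat (v + t • w) h' = headMat v h' + t • headMat w h' := by
    intro t h'
    ext p q
    simp [headMat]
  -- derivative along the line from the gradient
  have hline1 : HasDerivAt (fun t : ℝ => f (v + t • w)) (frob W ^ 2) 0 := by
    have h1 := hd.hasGradientAt.hasFDerivAt.hasLineDerivAt w
    have e : (InnerProductSpace.toDual ℝ _ (gradient f v)) w = frob W ^ 2 := by
      rw [InnerProductSpace.toDual_apply_apply, frob_sq]
      simp only [PiLp.inner_apply, Fintype.sum_prod_type, hw]
      rw [Finset.sum_eq_single h]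
      · simp [hW, headMat, sq]
      · intro b _ hb; simp [hb]
      · simp
    rw [e] at h1
    exact h1
  have hMH : ∀ k, HasDerivAt (fun t : ℝ => MH (fun h' => Sgauss (headMat (v + t • w) h') (WK h') Xi)
      WV WO Xi k) (∑ j, dS (headMat v h) (WK h) W Xi k j * uvec (WV h) (WO h) Xi j) 0 := by
    intro k
    simp only [MH_eq, hhead]
    have h1 := HasDerivAt.fun_sum (u := Finset.univ) fun h' (_ : h' ∈ Finset.univ) =>
      HasDerivAt.fun_sum (u := Finset.univ) fun j (_ : j ∈ Finset.univ) =>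
        (S_deriv (headMat v h') (WK h') (headMat w h') Xi k j).mul_const
          (uvec (WV h') (WO h') Xi j)
    refine h1.congr_deriv ?_
    rw [Finset.sum_eq_single h]
    · simp [hwh]
    · intro b _ hb; simp [hwh, hb, dS]
    · simp
  have hline2 : HasDerivAt (fun t : ℝ => f (v + t • w))
      (∑ k, (MH (fun h' => Sgauss (headMat v h') (WK h') Xi) WV WO Xi k - yi k) *
        ∑ j, dS (headMat v h) (WK h) W Xi k j * uvec (WV h) (WO h) Xi j) 0 := by
    rw [hf]
    have h1 := (HasDerivAt.fun_sum (u := Finset.univ) fun k (_ : k ∈ Finset.univ) =>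
      ((hMH k).sub_const (yi k)).fun_pow 2).const_mul (1 / 2 : ℝ)
    refine h1.congr_deriv ?_
    rw [Finset.mul_sum]
    refine Finset.sum_congr rfl fun k _ => ?_
    simp
    ring
  have heq := hline1.unique hline2
  have hb := dir_bound Xi
    (fun k => MH (fun h' => Sgauss (headMat v h') (WK h') Xi) WV WO Xi k - yi k)
    (headMat v h) (WK h) W WV WO h
  rw [← heq] at hb
  rcases (frob_nonneg W).eq_or_lt with h0 | hpos
  · rw [← h0]
    have := sigmaMax_nonneg (diagWV WV)
    have := frob_nonneg Xi
    have : 0 ≤ WOnorm WO := Real.sqrt_nonneg _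
    have := enorm_nonneg'
      (fun k => MH (fun h' => Sgauss (headMat v h') (WK h') Xi) WV WO Xi k - yi k)
    positivity
  · rw [sq] at hb
    exact le_of_mul_le_mul_right hb hpos

end Paper
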